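/- For all real numbers τ and s, setting v = τ(s + √(1+s²)) and u = τ(√(1+s²) − s), one has sin²(arctan v − arctan u) = 4τ²s²/(4τ²s² + (1+τ²)²); that is, the compactified radial coordinate R = arctan v − arctan u satisfies sin²R = Ω²·τ²·s², which identifies the angular coefficient of the compactified metric Ω²g with sin²R·γ. -/

import Mathlib

theorem sin_arctan_sub_arctan_sq (x y : ℝ) :
    Real.sin (Real.arctan x - Real.arctan y) ^ 2
      = (x - y) ^ 2 / ((1 + x ^ 2) * (1 + y ^ 2)) := by
  have hx := Real.cos_sq_arctan x
  have hy := Real.cos_sq_arctan y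
  have h : Real.sin (Real.arctan x - Real.arctan y)
      = (x - y) * (Real.cos (Real.arctan x) * Real.cos (Real.arctan y)) := by
    rw [Real.sin_sub, ← Real.tan_mul_cos (Real.cos_arctan_pos x).ne',
      ← Real.tan_mul_cos (Real.cos_arctan_pos y).ne', Real.tan_arctan, Real.tan_arctan]
    ring
  rw [h, mul_pow, mul_pow, hx, hy, one_div_mul_one_div, mul_one_div]

/-- For all real numbers τ and s, with v = τ(s + √(1+s²)) and
u = τ(√(1+s²) − s), the compactified radial coordinate
R = arctan v − arctan u satisfies
sin²R = 4τ²s²/(4τ²s² + (1+τ²)²) = Ω²·τ²·s². -/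
theorem stmt_2 (τ s : ℝ)
    (v : ℝ) (hv : v = τ * (s + Real.sqrt (1 + s ^ 2)))
    (u : ℝ) (hu : u = τ * (Real.sqrt (1 + s ^ 2) - s)) :
    Real.sin (Real.arctan v - Real.arctan u) ^ 2
      = 4 * τ ^ 2 * s ^ 2 / (4 * τ ^ 2 * s ^ 2 + (1 + τ ^ 2) ^ 2) := by
  have hw : Real.sqrt (1 + s ^ 2) ^ 2 = 1 + s ^ 2 := Real.sq_sqrt (by positivity)
  have hsub : v - u = 2 * τ * s := by rw [hv, hu]; ring
  have hmul : v * u = τ ^ 2 := by rw [hv, hu]; linear_combination τ ^ 2 * hw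
  rw [sin_arctan_sub_arctan_sq]
  congr 1
  · rw [hsub]; ring
  · linear_combination (v - u + 2 * τ * s) * hsub + (v * u + τ ^ 2 + 2) * hmul
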